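/- arXiv:1206.3730 — 8 statements merged into one kernel-verified Lean document; each statement's English description precedes it below -/
import Mathlib

section
/- Let a, b, c : ℝ² → ℝ be smooth functions solving system (2). Then for any s ∈ ℝ, the functions ã(x,t) = a(x·e^{−s}, t), b̃(x,t) = e^{−2s}·b(x·e^{−s}, t), c̃(x,t) = e^{−s}·c(x·e^{−s}, t) also solve system (2). -/
/-- Partial derivative with respect to the first coordinate `x`. -/
noncomputable def pdx (f : ℝ × ℝ → ℝ) (p : ℝ × ℝ) : ℝ := fderiv ℝ f p (1, 0)

/-- Partial derivative with respect to the second coordinate `t`. -/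
noncomputable def pdt (f : ℝ × ℝ → ℝ) (p : ℝ × ℝ) : ℝ := fderiv ℝ f p (0, 1)

/-- The six equations of system (2) (Einstein equations of a 4-dimensional
Walker manifold whose defining functions depend only on `x`, `t`), at a point `p`. -/
def EinsteinWalkerAt (a b c : ℝ × ℝ → ℝ) (p : ℝ × ℝ) : Prop :=
  pdx (pdx a) p - pdt (pdt b) p = 0 ∧
  pdt (pdx b) p + pdx (pdx c) p = 0 ∧
  pdt (pdx a) p + pdt (pdt c) p = 0 ∧
  pdx a p * pdt c p + pdt a p * pdt b p - pdt a p * pdx c p - (pdt c p) ^ 2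
    + 2 * c p * pdt (pdx a) p + b p * pdt (pdt a) p - a p * pdt (pdx c) p = 0 ∧
  pdt a p * pdx b p - pdx c p * pdt c p + c p * pdx (pdx a) p - a p * pdx (pdx c) p
    - c p * pdt (pdx c) p - b p * pdt (pdt c) p = 0 ∧
  pdx a p * pdx b p - pdx b p * pdt c p + pdt b p * pdx c p - (pdx c p) ^ 2
    + a p * pdx (pdx b) p + 2 * c p * pdt (pdx b) p - b p * pdt (pdx c) p = 0

lemma fderiv_scaled_apply {f : ℝ × ℝ → ℝ} (hf : Differentiable ℝ f) (m k : ℝ)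
    (p v : ℝ × ℝ) :
    fderiv ℝ (fun q : ℝ × ℝ => m * f (q.1 * k, q.2)) p v
      = m * fderiv ℝ f (p.1 * k, p.2) (v.1 * k, v.2) := by
  have hφ : HasFDerivAt (fun q : ℝ × ℝ => (q.1 * k, q.2))
      ((k • ContinuousLinearMap.fst ℝ ℝ ℝ).prod (ContinuousLinearMap.snd ℝ ℝ ℝ)) p :=
    (hasFDerivAt_fst.mul_const k).prodMk hasFDerivAt_snd
  have hcomp := ((hf (p.1 * k, p.2)).hasFDerivAt.comp p hφ).const_mul m
  have heq := congrArg (fun L => L v) hcomp.fderiv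
  simpa [Function.comp_def, mul_comm] using heq

lemma pdx_scaled {f : ℝ × ℝ → ℝ} (hf : Differentiable ℝ f) (m k : ℝ) :
    pdx (fun q => m * f (q.1 * k, q.2)) = fun q => (m * k) * pdx f (q.1 * k, q.2) := by
  funext p
  have hv : ((1 : ℝ) * k, (0 : ℝ)) = k • ((1 : ℝ), (0 : ℝ)) := by simp
  simp only [pdx, fderiv_scaled_apply hf, hv, map_smul, smul_eq_mul]
  ring

lemma pdt_scaled {f : ℝ × ℝ → ℝ} (hf : Differentiable ℝ f) (m k : ℝ) :
    pdt (fun q => m * f (q.1 * k, q.2)) = fun q => m * pdt f (q.1 * k, q.2) := by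
  funext p
  simp only [pdt, fderiv_scaled_apply hf, zero_mul]

lemma ContDiff.differentiable_pdx {f : ℝ × ℝ → ℝ} (hf : ContDiff ℝ (⊤ : ℕ∞) f) :
    Differentiable ℝ (pdx f) :=
  ((hf.fderiv_right (m := 1) (by norm_cast)).clm_apply contDiff_const).differentiable
    one_ne_zero

lemma ContDiff.differentiable_pdt {f : ℝ × ℝ → ℝ} (hf : ContDiff ℝ (⊤ : ℕ∞) f) :
    Differentiable ℝ (pdt f) :=
  ((hf.fderiv_right (m := 1) (by norm_cast)).clm_apply contDiff_const).differentiable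
    one_ne_zero

/-- Scaling symmetry `g₃(s)`: if `(a,b,c)` is a smooth solution of system (2),
so is `(a(xe⁻ˢ,t), e⁻²ˢ b(xe⁻ˢ,t), e⁻ˢ c(xe⁻ˢ,t))`. -/
theorem g3_invariance (a b c : ℝ × ℝ → ℝ)
    (ha : ContDiff ℝ (⊤ : ℕ∞) a) (hb : ContDiff ℝ (⊤ : ℕ∞) b) (hc : ContDiff ℝ (⊤ : ℕ∞) c)
    (h : ∀ p, EinsteinWalkerAt a b c p) (s : ℝ) :
    ∀ p, EinsteinWalkerAt
      (fun q => a (q.1 * Real.exp (-s), q.2))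
      (fun q => Real.exp (-2 * s) * b (q.1 * Real.exp (-s), q.2))
      (fun q => Real.exp (-s) * c (q.1 * Real.exp (-s), q.2)) p := by
  intro p
  have hexp : Real.exp (-2 * s) = Real.exp (-s) ^ 2 := by
    rw [← Real.exp_nat_mul]
    congr 1
    push_cast
    ring
  rw [hexp]
  generalize Real.exp (-s) = k
  have ha_one : (fun q : ℝ × ℝ => a (q.1 * k, q.2)) = fun q => 1 * a (q.1 * k, q.2) := by
    simp
  have ha' : Differentiable ℝ a := ha.differentiable (by simp)
  have hb' : Differentiable ℝ b := hb.differentiable (by simp)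
  have hc' : Differentiable ℝ c := hc.differentiable (by simp)
  obtain ⟨h1, h2, h3, h4, h5, h6⟩ := h (p.1 * k, p.2)
  rw [ha_one]
  simp only [EinsteinWalkerAt, pdx_scaled ha', pdx_scaled hb', pdx_scaled hc',
    pdt_scaled ha', pdt_scaled hb', pdt_scaled hc',
    pdx_scaled ha.differentiable_pdx, pdx_scaled hb.differentiable_pdx,
    pdx_scaled hc.differentiable_pdx, pdt_scaled ha.differentiable_pdx,
    pdt_scaled hb.differentiable_pdx, pdt_scaled hc.differentiable_pdx,
    pdt_scaled ha.differentiable_pdt, pdt_scaled hb.differentiable_pdt,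
    pdt_scaled hc.differentiable_pdt]
  refine ⟨?_, ?_, ?_, ?_, ?_, ?_⟩
  · linear_combination k ^ 2 * h1
  · linear_combination k ^ 3 * h2
  · linear_combination k * h3
  · linear_combination k ^ 2 * h4
  · linear_combination k ^ 3 * h5
  · linear_combination k ^ 4 * h6
end

section
/- Let a, b, c : ℝ² → ℝ be smooth functions solving system (2). Then for any s ∈ ℝ, the functions ã(x,t) = a(x, t−sx), b̃(x,t) = s²·a(x, t−sx) + 2s·c(x, t−sx) + b(x, t−sx), c̃(x,t) = s·a(x, t−sx) + c(x, t−sx) also solve system (2). -/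
theorem ContDiff.pdx {f : ℝ × ℝ → ℝ} (hf : ContDiff ℝ (⊤ : ℕ∞) f) :
    ContDiff ℝ (⊤ : ℕ∞) (pdx f) :=
  (hf.fderiv_right (m := (⊤ : ℕ∞)) (by simp)).clm_apply contDiff_const

theorem ContDiff.pdt {f : ℝ × ℝ → ℝ} (hf : ContDiff ℝ (⊤ : ℕ∞) f) :
    ContDiff ℝ (⊤ : ℕ∞) (pdt f) :=
  (hf.fderiv_right (m := (⊤ : ℕ∞)) (by simp)).clm_apply contDiff_const

theorem pdx_pdt_comm {f : ℝ × ℝ → ℝ} (hf : ContDiff ℝ (⊤ : ℕ∞) f) :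
    pdx (pdt f) = pdt (pdx f) := by
  funext p
  have hd : DifferentiableAt ℝ (fderiv ℝ f) p :=
    (hf.fderiv_right (m := (⊤ : ℕ∞)) (by simp)).differentiable (by simp) p
  have key (u v : ℝ × ℝ) :
      fderiv ℝ (fun q => fderiv ℝ f q u) p v = fderiv ℝ (fderiv ℝ f) p v u := by
    rw [fderiv_clm_apply hd (differentiableAt_const u)]
    simp
  have hs : IsSymmSndFDerivAt ℝ f p := hf.contDiffAt.isSymmSndFDerivAt (by
    simpa using WithTop.coe_le_coe.2 (le_top : (2 : ℕ∞) ≤ ⊤))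
  exact (key (0, 1) (1, 0)).trans ((hs _ _).trans (key (1, 0) (0, 1)).symm)

theorem pdx_const_mul_add (k : ℝ) {f g : ℝ × ℝ → ℝ} (hf : Differentiable ℝ f)
    (hg : Differentiable ℝ g) :
    pdx (fun q => k * f q + g q) = fun q => k * pdx f q + pdx g q := by
  funext p
  simp only [pdx]
  rw [fderiv_fun_add ((hf p).const_mul k) (hg p), fderiv_const_mul (hf p)]
  simp

theorem pdt_const_mul_add (k : ℝ) {f g : ℝ × ℝ → ℝ} (hf : Differentiable ℝ f)
    (hg : Differentiable ℝ g) :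
    pdt (fun q => k * f q + g q) = fun q => k * pdt f q + pdt g q := by
  funext p
  simp only [pdt]
  rw [fderiv_fun_add ((hf p).const_mul k) (hg p), fderiv_const_mul (hf p)]
  simp

/-- The function `(x, t) ↦ f (x, t - s * x)`. -/
def shear (s : ℝ) (f : ℝ × ℝ → ℝ) (q : ℝ × ℝ) : ℝ := f (q.1, q.2 - s * q.1)

theorem ContDiff.shear (s : ℝ) {f : ℝ × ℝ → ℝ} (hf : ContDiff ℝ (⊤ : ℕ∞) f) :
    ContDiff ℝ (⊤ : ℕ∞) (shear s f) :=
  hf.comp (by fun_prop : ContDiff ℝ (⊤ : ℕ∞) fun q : ℝ × ℝ => (q.1, q.2 - s * q.1))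

theorem fderiv_shear (s : ℝ) {f : ℝ × ℝ → ℝ} (hf : Differentiable ℝ f) (p v : ℝ × ℝ) :
    fderiv ℝ (shear s f) p v = fderiv ℝ f (p.1, p.2 - s * p.1) (v.1, v.2 - s * v.1) := by
  have h : HasFDerivAt (fun q : ℝ × ℝ => (q.1, q.2 - s * q.1))
      ((ContinuousLinearMap.fst ℝ ℝ ℝ).prod
        (ContinuousLinearMap.snd ℝ ℝ ℝ - s • ContinuousLinearMap.fst ℝ ℝ ℝ)) p :=
    hasFDerivAt_fst.prodMk (hasFDerivAt_snd.sub (hasFDerivAt_fst.const_mul s))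
  have hc := (hf (p.1, p.2 - s * p.1)).hasFDerivAt.comp p h
  change HasFDerivAt (shear s f) _ p at hc
  rw [hc.fderiv]
  simp

theorem pdt_shear (s : ℝ) {f : ℝ × ℝ → ℝ} (hf : Differentiable ℝ f) :
    pdt (shear s f) = shear s (pdt f) := by
  funext p
  simp only [pdt, fderiv_shear s hf, shear, mul_zero, sub_zero]

theorem pdx_shear (s : ℝ) {f : ℝ × ℝ → ℝ} (hf : Differentiable ℝ f) :
    pdx (shear s f) = fun q => -s * shear s (pdt f) q + shear s (pdx f) q := by
  funext p
  have hv : ((1, 0 - s * 1) : ℝ × ℝ) = (-s) • (0, 1) + (1, 0) := by simp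
  simp only [pdx, pdt, fderiv_shear s hf, shear]
  rw [hv, map_add, map_smul, smul_eq_mul]

theorem pdt_pdx_shear (s : ℝ) {f : ℝ × ℝ → ℝ} (hf : ContDiff ℝ (⊤ : ℕ∞) f) :
    pdt (pdx (shear s f)) =
      fun q => -s * shear s (pdt (pdt f)) q + shear s (pdt (pdx f)) q := by
  have hd {g : ℝ × ℝ → ℝ} (hg : ContDiff ℝ (⊤ : ℕ∞) g) : Differentiable ℝ g :=
    hg.differentiable (by simp)
  rw [pdx_shear s (hd hf), pdt_const_mul_add _ (hd (hf.pdt.shear s)) (hd (hf.pdx.shear s)),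
    pdt_shear s (hd hf.pdt), pdt_shear s (hd hf.pdx)]

theorem pdx_pdx_shear (s : ℝ) {f : ℝ × ℝ → ℝ} (hf : ContDiff ℝ (⊤ : ℕ∞) f) :
    pdx (pdx (shear s f)) = fun q => s ^ 2 * shear s (pdt (pdt f)) q
      - 2 * s * shear s (pdt (pdx f)) q + shear s (pdx (pdx f)) q := by
  have hd {g : ℝ × ℝ → ℝ} (hg : ContDiff ℝ (⊤ : ℕ∞) g) : Differentiable ℝ g :=
    hg.differentiable (by simp)
  rw [pdx_shear s (hd hf), pdx_const_mul_add _ (hd (hf.pdt.shear s)) (hd (hf.pdx.shear s)),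
    pdx_shear s (hd hf.pdt), pdx_shear s (hd hf.pdx), pdx_pdt_comm hf]
  funext q
  ring

/-- Symmetry `g₄(s)`: if `(a,b,c)` is a smooth solution of system (2), so is
`(a(x,t−sx), s²a(x,t−sx) + 2sc(x,t−sx) + b(x,t−sx), sa(x,t−sx) + c(x,t−sx))`. -/
theorem g4_invariance (a b c : ℝ × ℝ → ℝ)
    (ha : ContDiff ℝ (⊤ : ℕ∞) a) (hb : ContDiff ℝ (⊤ : ℕ∞) b) (hc : ContDiff ℝ (⊤ : ℕ∞) c)
    (h : ∀ p, EinsteinWalkerAt a b c p) (s : ℝ) :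
    ∀ p, EinsteinWalkerAt
      (fun q => a (q.1, q.2 - s * q.1))
      (fun q => s ^ 2 * a (q.1, q.2 - s * q.1) + 2 * s * c (q.1, q.2 - s * q.1)
        + b (q.1, q.2 - s * q.1))
      (fun q => s * a (q.1, q.2 - s * q.1) + c (q.1, q.2 - s * q.1)) p := by
  intro p
  have hd {g : ℝ × ℝ → ℝ} (hg : ContDiff ℝ (⊤ : ℕ∞) g) : Differentiable ℝ g :=
    hg.differentiable (by simp)
  have hC : ContDiff ℝ (⊤ : ℕ∞) fun q => s * a q + c q := by fun_prop
  have hcb : ContDiff ℝ (⊤ : ℕ∞) fun q => 2 * s * c q + b q := by fun_prop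
  have hax := ha.pdx
  have hat := ha.pdt
  have hbx := hb.pdx
  have hbt := hb.pdt
  have hcx := hc.pdx
  have hct := hc.pdt
  have hcbx : ContDiff ℝ (⊤ : ℕ∞) fun q => 2 * s * pdx c q + pdx b q := by fun_prop
  have hcbt : ContDiff ℝ (⊤ : ℕ∞) fun q => 2 * s * pdt c q + pdt b q := by fun_prop
  have hB : ContDiff ℝ (⊤ : ℕ∞) fun q => s ^ 2 * a q + (2 * s * c q + b q) := by fun_prop
  have hB' : (fun q : ℝ × ℝ => s ^ 2 * a (q.1, q.2 - s * q.1)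
      + 2 * s * c (q.1, q.2 - s * q.1) + b (q.1, q.2 - s * q.1)) =
      shear s fun q => s ^ 2 * a q + (2 * s * c q + b q) := by
    funext q
    simp only [shear, add_assoc]
  rw [hB']
  change EinsteinWalkerAt (shear s a) _ (shear s fun q => s * a q + c q) p
  obtain ⟨h1, h2, h3, h4, h5, h6⟩ := h (p.1, p.2 - s * p.1)
  simp only [EinsteinWalkerAt, pdx_pdx_shear s ha, pdx_pdx_shear s hB, pdx_pdx_shear s hC,
    pdt_pdx_shear s ha, pdt_pdx_shear s hB, pdt_pdx_shear s hC]
  simp only [pdt_shear s (hd ha), pdt_shear s (hd hB), pdt_shear s (hd hC),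
    pdx_shear s (hd ha), pdx_shear s (hd hB), pdx_shear s (hd hC),
    pdt_shear s (hd hat), pdt_shear s (hd hB.pdt), pdt_shear s (hd hC.pdt)]
  simp only [shear, pdx_const_mul_add _ (hd ha) (hd hc), pdt_const_mul_add _ (hd ha) (hd hc),
    pdx_const_mul_add _ (hd ha) (hd hcb), pdt_const_mul_add _ (hd ha) (hd hcb),
    pdx_const_mul_add _ (hd hc) (hd hb), pdt_const_mul_add _ (hd hc) (hd hb),
    pdx_const_mul_add _ (hd hax) (hd hcx), pdt_const_mul_add _ (hd hax) (hd hcx),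
    pdt_const_mul_add _ (hd hat) (hd hct),
    pdx_const_mul_add _ (hd hcx) (hd hbx), pdt_const_mul_add _ (hd hcx) (hd hbx),
    pdt_const_mul_add _ (hd hct) (hd hbt),
    pdx_const_mul_add _ (hd hax) (hd hcbx), pdt_const_mul_add _ (hd hax) (hd hcbx),
    pdt_const_mul_add _ (hd hat) (hd hcbt)]
  clear h hB' hd
  generalize (p.1, p.2 - s * p.1) = q at *
  clear hC hcb hB hcbx hcbt
  refine ⟨?_, ?_, ?_, ?_, ?_, ?_⟩ <;> grind
end

section
/- Let r₁, r₂, r₃, r₄ ∈ ℝ with r₁ ≠ 0. Then the functions a(x,t) = r₁x + r₂, c(x,t) = r₃x + r₄, and b(x,t) = (r₃²/r₁)x − (r₂r₃²/r₁²)·ln(r₁x + r₂) satisfy all six equations of system (2) at every point (x,t) of the open set where r₁x + r₂ > 0. -/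
theorem differentiableAt_comp_fst_iff (g : ℝ → ℝ) (p : ℝ × ℝ) :
    DifferentiableAt ℝ (fun q : ℝ × ℝ => g q.1) p ↔ DifferentiableAt ℝ g p.1 := by
  refine ⟨fun h => ?_, fun h => h.comp p differentiableAt_fst⟩
  exact DifferentiableAt.comp (f := fun x : ℝ => (x, p.2)) p.1 h (by fun_prop)

theorem fderiv_comp_fst_apply (g : ℝ → ℝ) (p v : ℝ × ℝ) :
    fderiv ℝ (fun q : ℝ × ℝ => g q.1) p v = v.1 * deriv g p.1 := by
  by_cases h : DifferentiableAt ℝ g p.1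
  · have := h.hasDerivAt.hasFDerivAt.comp p (hasFDerivAt_fst (𝕜 := ℝ) (p := p))
    have h2 : fderiv ℝ (fun q : ℝ × ℝ => g q.1) p = _ := this.fderiv
    simp [h2]
  · rw [fderiv_zero_of_not_differentiableAt (mt (differentiableAt_comp_fst_iff g p).1 h),
      deriv_zero_of_not_differentiableAt h]
    simp

theorem pdx_comp_fst (g : ℝ → ℝ) :
    pdx (fun q => g q.1) = fun q => deriv g q.1 := by
  ext p
  simp [pdx, fderiv_comp_fst_apply]

theorem pdt_comp_fst (g : ℝ → ℝ) : pdt (fun q => g q.1) = fun _ => 0 := by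
  ext p
  simp [pdt, fderiv_comp_fst_apply]

theorem pdt_const (k : ℝ) : pdt (fun _ => k) = fun _ => 0 := pdt_comp_fst fun _ => k

/-- For functions of `x` alone, system (2) reduces to ordinary differential equations. -/
theorem einsteinWalkerAt_comp_fst {a b c : ℝ → ℝ} {p : ℝ × ℝ}
    (ha : deriv (deriv a) p.1 = 0) (hc : deriv (deriv c) p.1 = 0)
    (hb : deriv a p.1 * deriv b p.1 - deriv c p.1 ^ 2 + a p.1 * deriv (deriv b) p.1 = 0) :
    EinsteinWalkerAt (fun q => a q.1) (fun q => b q.1) (fun q => c q.1) p := by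
  simp only [EinsteinWalkerAt, pdx_comp_fst, pdt_comp_fst, pdt_const, ha, hc]
  refine ⟨by ring, by ring, by ring, by ring, by ring, ?_⟩
  linear_combination hb

theorem deriv_affine (m k : ℝ) : deriv (fun x : ℝ => m * x + k) = fun _ => m := by
  ext x
  simp

theorem hasDerivAt_affine (m k x : ℝ) : HasDerivAt (fun x : ℝ => m * x + k) m x := by
  simpa using ((hasDerivAt_id x).const_mul m).add_const k

/-- The explicit solution `a = r₁x + r₂`, `c = r₃x + r₄`,
`b = (r₃²/r₁)x − (r₂r₃²/r₁²)·ln(r₁x + r₂)` satisfies system (2)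
wherever `r₁x + r₂ > 0`. -/
theorem example_solution (r₁ r₂ r₃ r₄ : ℝ) (hr₁ : r₁ ≠ 0) :
    ∀ p : ℝ × ℝ, r₁ * p.1 + r₂ > 0 →
      EinsteinWalkerAt
        (fun q => r₁ * q.1 + r₂)
        (fun q => r₃ ^ 2 / r₁ * q.1 - r₂ * r₃ ^ 2 / r₁ ^ 2 * Real.log (r₁ * q.1 + r₂))
        (fun q => r₃ * q.1 + r₄) p := by
  intro p hp
  set L : ℝ → ℝ := fun x => r₁ * x + r₂ with hL
  have hb : ∀ x, L x ≠ 0 → HasDerivAt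
      (fun x => r₃ ^ 2 / r₁ * x - r₂ * r₃ ^ 2 / r₁ ^ 2 * Real.log (r₁ * x + r₂))
      (r₃ ^ 2 / r₁ - r₂ * r₃ ^ 2 / r₁ ^ 2 * (r₁ / L x)) x := fun x hx => by
    have h := ((hasDerivAt_id x).const_mul (r₃ ^ 2 / r₁)).sub
      (((hasDerivAt_affine r₁ r₂ x).log hx).const_mul (r₂ * r₃ ^ 2 / r₁ ^ 2))
    rw [mul_one] at h
    exact h
  have hp0 : L p.1 ≠ 0 := hp.ne'
  have hev : deriv (fun x => r₃ ^ 2 / r₁ * x - r₂ * r₃ ^ 2 / r₁ ^ 2 * Real.log (r₁ * x + r₂))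
      =ᶠ[nhds p.1] fun x => r₃ ^ 2 / r₁ - r₂ * r₃ ^ 2 / r₁ ^ 2 * (r₁ / L x) := by
    filter_upwards [(hasDerivAt_affine r₁ r₂ p.1).continuousAt.eventually_ne hp0] with x hx
    exact (hb x hx).deriv
  have hbb : HasDerivAt (fun x => r₃ ^ 2 / r₁ - r₂ * r₃ ^ 2 / r₁ ^ 2 * (r₁ / L x))
      (-(r₂ * r₃ ^ 2 / r₁ ^ 2 * (-(r₁ * r₁) / L p.1 ^ 2))) p.1 := by
    have h := (((hasDerivAt_const p.1 r₁).div (hasDerivAt_affine r₁ r₂ p.1) hp0).const_mul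
      (r₂ * r₃ ^ 2 / r₁ ^ 2)).const_sub (r₃ ^ 2 / r₁)
    rw [zero_mul, zero_sub] at h
    exact h
  refine einsteinWalkerAt_comp_fst (a := L)
    (b := fun x => r₃ ^ 2 / r₁ * x - r₂ * r₃ ^ 2 / r₁ ^ 2 * Real.log (r₁ * x + r₂))
    (c := fun x => r₃ * x + r₄) ?_ ?_ ?_
  · simp [hL]
  · simp
  · rw [hev.deriv_eq, hbb.deriv, (hb p.1 hp0).deriv, hL, deriv_affine, deriv_affine]
    have hp1 : r₁ * p.1 + r₂ ≠ 0 := hp0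
    field_simp
    ring
end

section
/- On ℝ⁵ with coordinates (x,t,a,b,c), the vector fields X₄(x,t,a,b,c) = (0, x, 0, 2c, a) and X₅(x,t,a,b,c) = (t, 0, 2c, 0, b) satisfy the Lie bracket relation [X₄, X₅] = X₃ − X₆ + 2X₇, where X₃(x,t,a,b,c) = (x, 0, 0, −2b, −c), X₆(x,t,a,b,c) = (0, t, 0, 2b, c), and X₇(x,t,a,b,c) = (0, 0, a, b, c). -/
/-- `ℝ⁵` with coordinates `(x, t, a, b, c)`. -/
abbrev V5 := ℝ × ℝ × ℝ × ℝ × ℝ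

/-- Lie bracket of vector fields on `ℝ⁵`:
`[V, W](p) = DW(p)(V(p)) − DV(p)(W(p))`. -/
noncomputable def lieBracketVF (V W : V5 → V5) : V5 → V5 :=
  fun p => fderiv ℝ W p (V p) - fderiv ℝ V p (W p)

def X1 : V5 → V5 := fun _ => (1, 0, 0, 0, 0)
def X2 : V5 → V5 := fun _ => (0, 1, 0, 0, 0)
def X3 : V5 → V5 := fun p => (p.1, 0, 0, -2 * p.2.2.2.1, -p.2.2.2.2)
def X4 : V5 → V5 := fun p => (0, p.1, 0, 2 * p.2.2.2.2, p.2.2.1)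
def X5 : V5 → V5 := fun p => (p.2.1, 0, 2 * p.2.2.2.2, 0, p.2.2.2.1)
def X6 : V5 → V5 := fun p => (0, p.2.1, 0, 2 * p.2.2.2.1, p.2.2.2.2)
def X7 : V5 → V5 := fun p => (0, 0, p.2.2.1, p.2.2.2.1, p.2.2.2.2)

/-- The derivative of a linear vector field on `ℝ⁵` is the field itself. -/
theorem fderiv_apply_of_isLinearMap {V : V5 → V5} (hV : IsLinearMap ℝ V) (p v : V5) :
    fderiv ℝ V p v = V v :=
  congrArg (fun L : V5 →L[ℝ] V5 => L v)
    (LinearMap.toContinuousLinearMap hV.mk').fderiv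

theorem isLinearMap_X4 : IsLinearMap ℝ X4 := by
  constructor <;> intros <;> simp [X4] <;> ring

theorem isLinearMap_X5 : IsLinearMap ℝ X5 := by
  constructor <;> intros <;> simp [X5] <;> ring

/-- The commutator relation `[X₄, X₅] = X₃ − X₆ + 2X₇`. -/
theorem bracket_X4_X5 :
    lieBracketVF X4 X5 = fun p => X3 p - X6 p + (2 : ℝ) • X7 p := by
  funext p
  simp only [lieBracketVF, fderiv_apply_of_isLinearMap isLinearMap_X4,
    fderiv_apply_of_isLinearMap isLinearMap_X5]
  ext <;> simp [X3, X4, X5, X6, X7] <;> ring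
end

section
/- On ℝ⁵ with coordinates (x,t,a,b,c), the vector field X₇(x,t,a,b,c) = (0, 0, a, b, c) commutes with each of the vector fields X₁ = (1,0,0,0,0), X₂ = (0,1,0,0,0), X₃(x,t,a,b,c) = (x,0,0,−2b,−c), X₄(x,t,a,b,c) = (0,x,0,2c,a), X₅(x,t,a,b,c) = (t,0,2c,0,b), and X₆(x,t,a,b,c) = (0,t,0,2b,c); that is, [X₇, Xᵢ] = 0 for i = 1,…,6. -/
/-- The bracket of two linear vector fields is the commutator of the underlying maps. -/
theorem lieBracketVF_of_isLinearMap {V W : V5 → V5} (hV : IsLinearMap ℝ V)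
    (hW : IsLinearMap ℝ W) (p : V5) : lieBracketVF V W p = W (V p) - V (W p) := by
  simp only [lieBracketVF, fderiv_apply_of_isLinearMap hV, fderiv_apply_of_isLinearMap hW]

/-- The bracket of a linear vector field with a constant one. -/
theorem lieBracketVF_const {V : V5 → V5} (hV : IsLinearMap ℝ V) (w p : V5) :
    lieBracketVF V (fun _ => w) p = -V w := by
  simp [lieBracketVF, fderiv_apply_of_isLinearMap hV]

theorem isLinearMap_X3 : IsLinearMap ℝ X3 := by
  constructor <;> intros <;> ext <;> simp [X3] <;> ring

theorem isLinearMap_X6 : IsLinearMap ℝ X6 := by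
  constructor <;> intros <;> ext <;> simp [X6] <;> ring

theorem isLinearMap_X7 : IsLinearMap ℝ X7 := by
  constructor <;> intros <;> ext <;> simp [X7]

/-- `X₇` is central: `[X₇, Xᵢ] = 0` for `i = 1, …, 6`. -/
theorem X7_central :
    lieBracketVF X7 X1 = 0 ∧ lieBracketVF X7 X2 = 0 ∧ lieBracketVF X7 X3 = 0 ∧
    lieBracketVF X7 X4 = 0 ∧ lieBracketVF X7 X5 = 0 ∧ lieBracketVF X7 X6 = 0 := by
  refine ⟨?_, ?_, ?_, ?_, ?_, ?_⟩ <;> funext p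
  · exact (lieBracketVF_const isLinearMap_X7 _ p).trans (by simp [X7])
  · exact (lieBracketVF_const isLinearMap_X7 _ p).trans (by simp [X7])
  · rw [lieBracketVF_of_isLinearMap isLinearMap_X7 isLinearMap_X3]
    simp [X7, X3]
  · rw [lieBracketVF_of_isLinearMap isLinearMap_X7 isLinearMap_X4]
    simp [X7, X4]
  · rw [lieBracketVF_of_isLinearMap isLinearMap_X7 isLinearMap_X5]
    simp [X7, X5]
  · rw [lieBracketVF_of_isLinearMap isLinearMap_X7 isLinearMap_X6]
    simp [X7, X6]
end

section
/- On ℝ⁵ with coordinates (x,t,a,b,c), the real linear span of the seven vector fields X₁ = (1,0,0,0,0), X₂ = (0,1,0,0,0), X₃(x,t,a,b,c) = (x,0,0,−2b,−c), X₄(x,t,a,b,c) = (0,x,0,2c,a), X₅(x,t,a,b,c) = (t,0,2c,0,b), X₆(x,t,a,b,c) = (0,t,0,2b,c), X₇(x,t,a,b,c) = (0,0,a,b,c) is closed under the Lie bracket of vector fields: for any V, W in this span, [V, W] again lies in the span. -/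
/-- The linear part of the combination of `X1, …, X7` with coefficients `v`. -/
noncomputable def linearPart (v : Fin 7 → ℝ) : V5 →ₗ[ℝ] V5 where
  toFun p := v 2 • X3 p + v 3 • X4 p + v 4 • X5 p + v 5 • X6 p + v 6 • X7 p
  map_add' p q := by
    ext <;> simp [X3, X4, X5, X6, X7] <;> ring
  map_smul' r p := by
    ext <;> simp [X3, X4, X5, X6, X7] <;> ring

/-- The combination of `X1, …, X7` with coefficients `v`. -/
noncomputable def combination (v : Fin 7 → ℝ) : V5 → V5 :=
  v 0 • X1 + v 1 • X2 + v 2 • X3 + v 3 • X4 + v 4 • X5 + v 5 • X6 + v 6 • X7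

theorem mem_span_iff_exists_combination (V : V5 → V5) :
    V ∈ Submodule.span ℝ ({X1, X2, X3, X4, X5, X6, X7} : Set (V5 → V5)) ↔
      ∃ v, combination v = V := by
  have hrange : ({X1, X2, X3, X4, X5, X6, X7} : Set (V5 → V5)) =
      Set.range ![X1, X2, X3, X4, X5, X6, X7] := by
    simp only [Matrix.range_cons, Matrix.range_empty, Set.union_empty, Set.singleton_union]
  rw [hrange, Submodule.mem_span_range_iff_exists_fun]
  simp [Fin.sum_univ_seven, combination]

theorem fderiv_combination (v : Fin 7 → ℝ) (p q : V5) :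
    fderiv ℝ (combination v) p q = linearPart v q := by
  have h : combination v =
      fun p => (v 0, v 1, 0, 0, 0) + LinearMap.toContinuousLinearMap (linearPart v) p := by
    funext p
    ext <;> simp [combination, linearPart, X1, X2, X3, X4, X5, X6, X7, add_assoc]
  rw [h, fderiv_const_add, ContinuousLinearMap.fderiv]
  rfl

theorem lieBracketVF_combination (v w : Fin 7 → ℝ) :
    lieBracketVF (combination v) (combination w) =
      combination ![w 2 * v 0 + w 4 * v 1 - (v 2 * w 0 + v 4 * w 1),
        w 3 * v 0 + w 5 * v 1 - (v 3 * w 0 + v 5 * w 1),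
        v 3 * w 4 - v 4 * w 3,
        v 2 * w 3 - v 3 * w 2 + (v 3 * w 5 - v 5 * w 3),
        v 4 * w 2 - v 2 * w 4 + (v 5 * w 4 - v 4 * w 5),
        v 4 * w 3 - v 3 * w 4,
        2 * (v 3 * w 4 - v 4 * w 3)] := by
  funext p
  simp only [lieBracketVF, fderiv_combination]
  ext <;> simp [combination, linearPart, X1, X2, X3, X4, X5, X6, X7] <;> ring

/-- The span of `X₁, …, X₇` is closed under the Lie bracket of vector fields:
the symmetry generators of system (2) form a (7-dimensional) Lie algebra. -/
theorem span_closed_under_bracket :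
    ∀ V ∈ Submodule.span ℝ ({X1, X2, X3, X4, X5, X6, X7} : Set (V5 → V5)),
    ∀ W ∈ Submodule.span ℝ ({X1, X2, X3, X4, X5, X6, X7} : Set (V5 → V5)),
      lieBracketVF V W ∈
        Submodule.span ℝ ({X1, X2, X3, X4, X5, X6, X7} : Set (V5 → V5)) := by
  intro V hV W hW
  obtain ⟨v, rfl⟩ := (mem_span_iff_exists_combination V).1 hV
  obtain ⟨w, rfl⟩ := (mem_span_iff_exists_combination W).1 hW
  exact (mem_span_iff_exists_combination _).2 ⟨_, (lieBracketVF_combination v w).symm⟩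
end

section
/- Let r₁, r₂ ∈ ℝ. The functions a(x,t) = r₂²/(r₂t + r₁), b(x,t) = (r₂t + r₁)/x², c(x,t) = r₂/x satisfy all six equations of system (2) at every point (x,t) of the open set where x ≠ 0 and r₂t + r₁ ≠ 0. -/
/-- The open set on which `x ≠ 0` and `r₂t + r₁ ≠ 0`. -/
def regularSet (r₁ r₂ : ℝ) : Set (ℝ × ℝ) := {q | q.1 ≠ 0 ∧ r₂ * q.2 + r₁ ≠ 0}

/-- The Laurent monomial `k xⁱ (r₂t + r₁)ʲ`. -/
noncomputable def laurentMonomial (r₁ r₂ k : ℝ) (i j : ℤ) (q : ℝ × ℝ) : ℝ :=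
  k * q.1 ^ i * (r₂ * q.2 + r₁) ^ j

theorem isOpen_regularSet (r₁ r₂ : ℝ) : IsOpen (regularSet r₁ r₂) :=
  (isOpen_ne_fun continuous_fst continuous_const).inter
    (isOpen_ne_fun (by fun_prop) continuous_const)

theorem hasFDerivAt_laurentMonomial {r₁ r₂ : ℝ} (k : ℝ) (i j : ℤ) {q : ℝ × ℝ}
    (hq : q ∈ regularSet r₁ r₂) :
    HasFDerivAt (laurentMonomial r₁ r₂ k i j)
      (laurentMonomial r₁ r₂ (k * i) (i - 1) j q • ContinuousLinearMap.fst ℝ ℝ ℝ +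
        laurentMonomial r₁ r₂ (k * (j * r₂)) i (j - 1) q • ContinuousLinearMap.snd ℝ ℝ ℝ) q := by
  have hx := (hasDerivAt_zpow i q.1 (Or.inl hq.1)).comp_hasFDerivAt q
    (hasFDerivAt_fst (𝕜 := ℝ) (p := q))
  have hs := (hasDerivAt_zpow j (r₂ * q.2 + r₁) (Or.inl hq.2)).comp_hasFDerivAt q
    (((hasFDerivAt_snd (𝕜 := ℝ) (p := q)).const_mul r₂).add_const r₁)
  refine ((hx.const_mul k).mul hs).congr_fderiv ?_
  ext <;> simp [laurentMonomial] <;> ring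

theorem eqOn_pdx {f : ℝ × ℝ → ℝ} {r₁ r₂ k : ℝ} {i j : ℤ}
    (h : Set.EqOn f (laurentMonomial r₁ r₂ k i j) (regularSet r₁ r₂)) :
    Set.EqOn (pdx f) (laurentMonomial r₁ r₂ (k * i) (i - 1) j) (regularSet r₁ r₂) := by
  intro q hq
  have hf := h.eventuallyEq_of_mem ((isOpen_regularSet r₁ r₂).mem_nhds hq)
  rw [pdx, hf.fderiv_eq, (hasFDerivAt_laurentMonomial k i j hq).fderiv]
  simp

theorem eqOn_pdt {f : ℝ × ℝ → ℝ} {r₁ r₂ k : ℝ} {i j : ℤ}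
    (h : Set.EqOn f (laurentMonomial r₁ r₂ k i j) (regularSet r₁ r₂)) :
    Set.EqOn (pdt f) (laurentMonomial r₁ r₂ (k * (j * r₂)) i (j - 1)) (regularSet r₁ r₂) := by
  intro q hq
  have hf := h.eventuallyEq_of_mem ((isOpen_regularSet r₁ r₂).mem_nhds hq)
  rw [pdt, hf.fderiv_eq, (hasFDerivAt_laurentMonomial k i j hq).fderiv]
  simp

/-- The group-invariant solution for `X₃`: `a = r₂²/(r₂t + r₁)`,
`b = (r₂t + r₁)/x²`, `c = r₂/x` solves system (2) wherever
`x ≠ 0` and `r₂t + r₁ ≠ 0`. -/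
theorem invariant_solution_X3 (r₁ r₂ : ℝ) :
    ∀ p : ℝ × ℝ, p.1 ≠ 0 → r₂ * p.2 + r₁ ≠ 0 →
      EinsteinWalkerAt
        (fun q => r₂ ^ 2 / (r₂ * q.2 + r₁))
        (fun q => (r₂ * q.2 + r₁) / q.1 ^ 2)
        (fun q => r₂ / q.1) p := by
  intro p hx hs
  have hp : p ∈ regularSet r₁ r₂ := ⟨hx, hs⟩
  have ha : Set.EqOn (fun q : ℝ × ℝ => r₂ ^ 2 / (r₂ * q.2 + r₁))
      (laurentMonomial r₁ r₂ (r₂ ^ 2) 0 (-1)) (regularSet r₁ r₂) := by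
    intro q _
    simp [laurentMonomial, div_eq_mul_inv]
  have hb : Set.EqOn (fun q : ℝ × ℝ => (r₂ * q.2 + r₁) / q.1 ^ 2)
      (laurentMonomial r₁ r₂ 1 (-2) 1) (regularSet r₁ r₂) := by
    intro q _
    simp [laurentMonomial, div_eq_inv_mul, zpow_neg, zpow_ofNat]
  have hc : Set.EqOn (fun q : ℝ × ℝ => r₂ / q.1)
      (laurentMonomial r₁ r₂ r₂ (-1) 0) (regularSet r₁ r₂) := by
    intro q _
    simp [laurentMonomial, div_eq_mul_inv]
  rw [EinsteinWalkerAt,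
    eqOn_pdx ha hp, eqOn_pdt ha hp, eqOn_pdx (eqOn_pdx ha) hp, eqOn_pdt (eqOn_pdx ha) hp,
    eqOn_pdt (eqOn_pdt ha) hp, eqOn_pdx hb hp, eqOn_pdt hb hp, eqOn_pdx (eqOn_pdx hb) hp,
    eqOn_pdt (eqOn_pdx hb) hp, eqOn_pdt (eqOn_pdt hb) hp, eqOn_pdx hc hp, eqOn_pdt hc hp,
    eqOn_pdx (eqOn_pdx hc) hp, eqOn_pdt (eqOn_pdx hc) hp, eqOn_pdt (eqOn_pdt hc) hp]
  simp only [laurentMonomial]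
  refine ⟨?_, ?_, ?_, ?_, ?_, ?_⟩ <;> norm_num [zpow_neg, zpow_ofNat] <;> field_simp <;> ring
end

section
/- Let r₁, r₂ ∈ ℝ with r₁ ≠ 0. The functions a(x,t) = −(r₂/r₁)·e^{r₁x + t}, b(x,t) = −r₁r₂·e^{r₁x + t}, c(x,t) = r₂·e^{r₁x + t} satisfy all six equations of system (2) at every point (x,t) ∈ ℝ². -/
theorem hasFDerivAt_const_mul_exp_linear (k r : ℝ) (p : ℝ × ℝ) :
    HasFDerivAt (fun q : ℝ × ℝ => k * Real.exp (r * q.1 + q.2))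
      (k • Real.exp (r * p.1 + p.2) •
        (r • ContinuousLinearMap.fst ℝ ℝ ℝ + ContinuousLinearMap.snd ℝ ℝ ℝ)) p :=
  (((hasFDerivAt_fst.const_mul r).add hasFDerivAt_snd).exp).const_mul k

theorem pdx_const_mul_exp_linear (k r : ℝ) :
    pdx (fun q => k * Real.exp (r * q.1 + q.2)) =
      fun q => k * r * Real.exp (r * q.1 + q.2) := by
  funext p
  rw [pdx, (hasFDerivAt_const_mul_exp_linear k r p).fderiv]
  simp
  ring

theorem pdt_const_mul_exp_linear (k r : ℝ) :
    pdt (fun q => k * Real.exp (r * q.1 + q.2)) =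
      fun q => k * Real.exp (r * q.1 + q.2) := by
  funext p
  rw [pdt, (hasFDerivAt_const_mul_exp_linear k r p).fderiv]
  simp

/-- The group-invariant solution for `X₂ + X₇`:
`a = −(r₂/r₁)e^{r₁x+t}`, `b = −r₁r₂e^{r₁x+t}`, `c = r₂e^{r₁x+t}`
solves system (2) everywhere. -/
theorem invariant_solution_X2_X7 (r₁ r₂ : ℝ) (hr₁ : r₁ ≠ 0) :
    ∀ p : ℝ × ℝ,
      EinsteinWalkerAt
        (fun q => -(r₂ / r₁) * Real.exp (r₁ * q.1 + q.2))
        (fun q => -(r₁ * r₂) * Real.exp (r₁ * q.1 + q.2))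
        (fun q => r₂ * Real.exp (r₁ * q.1 + q.2)) p := by
  intro p
  simp only [EinsteinWalkerAt, pdx_const_mul_exp_linear, pdt_const_mul_exp_linear]
  refine ⟨?_, ?_, ?_, ?_, ?_, ?_⟩ <;> field_simp <;> ring
end
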